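/- arXiv:2406.05157 — 4 statements merged into one kernel-verified Lean document; each statement's English description precedes it below -/
import Mathlib

section
/- For every integer n ≥ 2 and all i, j ∈ ZMod (2n), the subgroup of the dicyclic group Q_n generated by the two elements a i (= x^i) and xa j (= x^j y) equals the whole group Q_n if and only if gcd(i.val, n) = 1. -/
namespace QuaternionGroup

/-- The subgroup of elements `x ^ k` and `x ^ (j + k) y` with `k` in the kernel of a ring
homomorphism killing `n`. -/
def subgroupOfRingHom {n : ℕ} {R : Type*} [CommRing R] (f : ZMod (2 * n) →+* R)
    (hf : f n = 0) (j : ZMod (2 * n)) : Subgroup (QuaternionGroup n) where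
  carrier := {g | (∃ k, f k = 0 ∧ g = a k) ∨ ∃ k, f k = f j ∧ g = xa k}
  one_mem' := Or.inl ⟨0, map_zero f, rfl⟩
  mul_mem' := by
    rintro _ _ (⟨k, hk, rfl⟩ | ⟨k, hk, rfl⟩) (⟨l, hl, rfl⟩ | ⟨l, hl, rfl⟩)
    · exact Or.inl ⟨k + l, by simp [hk, hl], rfl⟩
    · exact Or.inr ⟨l - k, by simp [hk, hl], rfl⟩
    · exact Or.inr ⟨k + l, by simp [hk, hl], rfl⟩
    · exact Or.inl ⟨n + l - k, by rw [map_sub, map_add, hf, hk, hl]; ring, rfl⟩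
  inv_mem' := by
    rintro _ (⟨k, hk, rfl⟩ | ⟨k, hk, rfl⟩)
    · exact Or.inl ⟨-k, by simp [hk], rfl⟩
    · exact Or.inr ⟨n + k, by rw [map_add, hf, hk, zero_add], rfl⟩

theorem ringHom_one_eq_zero_of_closure_eq_top {n : ℕ} {R : Type*} [CommRing R]
    (f : ZMod (2 * n) →+* R) (hf : f n = 0) {i j : ZMod (2 * n)} (hi : f i = 0)
    (h : Subgroup.closure ({a i, xa j} : Set (QuaternionGroup n)) = ⊤) : (1 : R) = 0 := by
  have hle : Subgroup.closure ({a i, xa j} : Set (QuaternionGroup n)) ≤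
      subgroupOfRingHom f hf j := by
    rw [Subgroup.closure_le]
    rintro _ (rfl | rfl)
    · exact Or.inl ⟨i, hi, rfl⟩
    · exact Or.inr ⟨j, rfl, rfl⟩
  rw [h] at hle
  rcases hle (Subgroup.mem_top (a 1)) with ⟨k, hk, hak⟩ | ⟨k, -, hak⟩
  · rw [← map_one f, a.inj hak, hk]
  · cases hak

theorem eq_top_of_a_one_mem {n : ℕ} [NeZero n] {H : Subgroup (QuaternionGroup n)}
    {j : ZMod (2 * n)} (h₁ : a 1 ∈ H) (hj : xa j ∈ H) : H = ⊤ := by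
  have ha (k : ZMod (2 * n)) : a k ∈ H := by
    rw [← ZMod.natCast_zmod_val k, ← a_one_pow]
    exact pow_mem h₁ _
  rw [eq_top_iff]
  rintro (k | k) -
  · exact ha k
  · simpa using mul_mem hj (ha (k - j))

end QuaternionGroup

/-- For `n ≥ 2` and `i j : ZMod (2n)`, the elements `x^i` and `x^j y` of the dicyclic group
`Q_n` generate the whole group iff `gcd(i.val, n) = 1`. -/
theorem dicyclic_gen_a_xa (n : ℕ) (hn : 2 ≤ n) (i j : ZMod (2 * n)) :
    Subgroup.closure ({QuaternionGroup.a i, QuaternionGroup.xa j} :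
      Set (QuaternionGroup n)) = ⊤ ↔ Nat.gcd i.val n = 1 := by
  have : NeZero n := ⟨by omega⟩
  constructor
  · intro h
    have hdvd : Nat.gcd i.val n ∣ n := Nat.gcd_dvd_right _ _
    let f : ZMod (2 * n) →+* ZMod (Nat.gcd i.val n) :=
      ZMod.castHom (hdvd.mul_left 2) _
    have hf : f n = 0 := by
      rw [map_natCast, ZMod.natCast_eq_zero_iff]
      exact hdvd
    have hi : f i = 0 := by
      have hfi : f ((i.val : ℕ) : ZMod (2 * n)) = 0 := by
        rw [map_natCast, ZMod.natCast_eq_zero_iff]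
        exact Nat.gcd_dvd_left _ _
      exact (congrArg f (ZMod.natCast_zmod_val i)).symm.trans hfi
    have h1 := QuaternionGroup.ringHom_one_eq_zero_of_closure_eq_top f hf hi h
    rw [← Nat.cast_one, ZMod.natCast_eq_zero_iff] at h1
    exact Nat.dvd_one.mp h1
  · intro h
    have hi : QuaternionGroup.a i ∈
        Subgroup.closure ({QuaternionGroup.a i, QuaternionGroup.xa j} :
          Set (QuaternionGroup n)) := Subgroup.subset_closure (by simp)
    have hj : QuaternionGroup.xa j ∈
        Subgroup.closure ({QuaternionGroup.a i, QuaternionGroup.xa j} :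
          Set (QuaternionGroup n)) := Subgroup.subset_closure (by simp)
    refine QuaternionGroup.eq_top_of_a_one_mem ?_ hj
    have hbez := Nat.gcd_eq_gcd_ab i.val n
    rw [h, Nat.cast_one] at hbez
    have hai : (QuaternionGroup.a 1 : QuaternionGroup n) ^ i.val = QuaternionGroup.a i := by
      rw [QuaternionGroup.a_one_pow, ZMod.natCast_zmod_val]
    have han : (QuaternionGroup.a 1 : QuaternionGroup n) ^ n = QuaternionGroup.xa j ^ 2 := by
      rw [QuaternionGroup.a_one_pow, QuaternionGroup.xa_sq]
    rw [← zpow_one (QuaternionGroup.a 1), hbez, zpow_add, zpow_mul, zpow_mul, zpow_natCast,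
      zpow_natCast, hai, han]
    exact mul_mem (zpow_mem hi _) (zpow_mem (pow_mem hj 2) _)
end

section
/- For every integer n ≥ 2 and all i, j ∈ ZMod (2n), the subgroup of the dicyclic group Q_n generated by the two elements xa i (= x^i y) and xa j (= x^j y) equals the whole group Q_n if and only if gcd((i - j).val, n) = 1. -/
namespace QuaternionGroup

variable {n : ℕ}

theorem xa_mul_xa_inv (i j : ZMod (2 * n)) : xa j * (xa i)⁻¹ = a (i - j) := by
  rw [mul_inv_eq_iff_eq_mul, a_mul_xa]
  congr 1
  ring

theorem a_mem_of_a_one_mem [NeZero n] {H : Subgroup (QuaternionGroup n)} (h : a 1 ∈ H)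
    (k : ZMod (2 * n)) : a k ∈ H := by
  rw [← ZMod.natCast_zmod_val k, ← a_one_pow]
  exact H.pow_mem h _

theorem eq_top_of_a_one_mem_of_xa_mem [NeZero n] {H : Subgroup (QuaternionGroup n)}
    (h : a 1 ∈ H) {i : ZMod (2 * n)} (hi : xa i ∈ H) : H = ⊤ := by
  rw [Subgroup.eq_top_iff']
  rintro (k | k)
  · exact a_mem_of_a_one_mem h k
  · have := H.mul_mem hi (a_mem_of_a_one_mem h (k - i))
    rwa [xa_mul_a, add_sub_cancel] at this

/-- If `i` and `j` agree under a ring homomorphism `f` killing `n`, then every rotation `a k` in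
the subgroup generated by `xa i` and `xa j` satisfies `f k = 0`. -/
theorem map_eq_zero_of_a_mem_closure {R : Type*} [Ring R] (f : ZMod (2 * n) →+* R)
    (hn : (n : R) = 0) {i j k : ZMod (2 * n)} (hij : f i = f j)
    (hk : a k ∈ Subgroup.closure ({xa i, xa j} : Set (QuaternionGroup n))) : f k = 0 := by
  let H : Subgroup (QuaternionGroup n) :=
    { carrier := {g | (∃ k, g = a k ∧ f k = 0) ∨ ∃ k, g = xa k ∧ f k = f i}
      one_mem' := Or.inl ⟨0, one_def, map_zero f⟩
      mul_mem' := by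
        rintro _ _ (⟨k, rfl, hk⟩ | ⟨k, rfl, hk⟩) (⟨l, rfl, hl⟩ | ⟨l, rfl, hl⟩) <;>
          simp [hk, hl, hn]
      inv_mem' := by
        rintro _ (⟨k, rfl, hk⟩ | ⟨k, rfl, hk⟩)
        · exact Or.inl ⟨-k, rfl, by simp [hk]⟩
        · exact Or.inr ⟨n + k, rfl, by simp [hk, hn]⟩ }
  have hle : Subgroup.closure ({xa i, xa j} : Set (QuaternionGroup n)) ≤ H := by
    rw [Subgroup.closure_le]
    rintro _ (rfl | rfl)
    · exact Or.inr ⟨i, rfl, rfl⟩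
    · exact Or.inr ⟨j, rfl, hij.symm⟩
  rcases hle hk with ⟨l, hl, h⟩ | ⟨l, hl, -⟩
  · rwa [a.inj hl]
  · cases hl

end QuaternionGroup

/-- For `n ≥ 2` and `i j : ZMod (2n)`, the elements `x^i y` and `x^j y` of the dicyclic group
`Q_n` generate the whole group iff `gcd((i-j).val, n) = 1`. -/
theorem dicyclic_gen_xa_xa (n : ℕ) (hn : 2 ≤ n) (i j : ZMod (2 * n)) :
    Subgroup.closure ({QuaternionGroup.xa i, QuaternionGroup.xa j} :
      Set (QuaternionGroup n)) = ⊤ ↔ Nat.gcd (i - j).val n = 1 := by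
  have : NeZero n := ⟨by omega⟩
  constructor
  · intro h
    set d := Nat.gcd (i - j).val n
    have hdn : d ∣ n := Nat.gcd_dvd_right _ _
    let f := ZMod.castHom (hdn.mul_left 2) (ZMod d)
    have hf : f (i - j) = 0 := by
      rw [← ZMod.natCast_zmod_val (i - j), map_natCast, ZMod.natCast_eq_zero_iff]
      exact Nat.gcd_dvd_left _ _
    have h_one : f 1 = 0 :=
      QuaternionGroup.map_eq_zero_of_a_mem_closure f ((ZMod.natCast_eq_zero_iff n d).2 hdn)
        (sub_eq_zero.1 (by rw [← map_sub, hf])) (h ▸ Subgroup.mem_top _)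
    rw [map_one, ← Nat.cast_one, ZMod.natCast_eq_zero_iff] at h_one
    exact Nat.dvd_one.1 h_one
  · intro h
    set H := Subgroup.closure
      ({QuaternionGroup.xa i, QuaternionGroup.xa j} : Set (QuaternionGroup n))
    have hi : QuaternionGroup.xa i ∈ H := Subgroup.subset_closure (by simp)
    have hj : QuaternionGroup.xa j ∈ H := Subgroup.subset_closure (by simp)
    have h_sub : (QuaternionGroup.a 1 : QuaternionGroup n) ^ (i - j).val ∈ H := by
      rw [QuaternionGroup.a_one_pow, ZMod.natCast_zmod_val, ← QuaternionGroup.xa_mul_xa_inv]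
      exact H.mul_mem hj (H.inv_mem hi)
    have h_n : (QuaternionGroup.a 1 : QuaternionGroup n) ^ n ∈ H := by
      rw [QuaternionGroup.a_one_pow, ← QuaternionGroup.xa_sq i]
      exact H.pow_mem hi 2
    refine QuaternionGroup.eq_top_of_a_one_mem_of_xa_mem ?_ hi
    have hb := Nat.gcd_eq_gcd_ab (i - j).val n
    rw [h, Nat.cast_one] at hb
    rw [← zpow_one (QuaternionGroup.a 1), hb, zpow_add, zpow_mul, zpow_mul, zpow_natCast,
      zpow_natCast]
    exact H.mul_mem (H.zpow_mem h_sub _) (H.zpow_mem h_n _)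
end

section
/- For every integer n ≥ 2, the number of ordered pairs (g,h) ∈ Q_n × Q_n such that the subgroup generated by {g,h} is all of Q_n equals 12·n·φ(n). Consequently the probability that two distinct randomly chosen elements of Q_n generate Q_n equals 3φ(n)/(4n−1). -/
open scoped Classical

namespace QuaternionGroup

variable {n : ℕ}

/-- Reduction of exponents modulo `n`. -/
def expMod (n : ℕ) : ZMod (2 * n) →+* ZMod n :=
  ZMod.castHom (Dvd.intro_left 2 rfl) (ZMod n)

theorem expMod_natCast_self : expMod n (n : ZMod (2 * n)) = 0 := by
  simp

theorem natCast_dvd_of_expMod_eq_zero [NeZero n] {k : ZMod (2 * n)} (hk : expMod n k = 0) :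
    (n : ZMod (2 * n)) ∣ k := by
  rw [← ZMod.natCast_zmod_val k, map_natCast, ZMod.natCast_eq_zero_iff] at hk
  rw [← ZMod.natCast_zmod_val k]
  exact Nat.cast_dvd_cast hk

theorem inv_a (i : ZMod (2 * n)) : (a i)⁻¹ = a (-i) := rfl

theorem inv_xa (i : ZMod (2 * n)) : (xa i)⁻¹ = xa ((n : ZMod (2 * n)) + i) := rfl

theorem a_pow (i : ZMod (2 * n)) (m : ℕ) : a i ^ m = a ((m : ZMod (2 * n)) * i) := by
  induction m with
  | zero => simp
  | succ m ih => rw [pow_succ, ih, a_mul_a]; push_cast; ring_nf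

theorem a_mem_of_dvd [NeZero n] {H : Subgroup (QuaternionGroup n)} {i k : ZMod (2 * n)}
    (hi : a i ∈ H) (hik : i ∣ k) : a k ∈ H := by
  obtain ⟨m, rfl⟩ := hik
  have h := H.pow_mem hi m.val
  rwa [a_pow, ZMod.natCast_zmod_val, mul_comm] at h

/-- The elements `a k` with `k` divisible by `i` modulo `n`, together with the elements `xa k`
with `k - j` divisible by `i` modulo `n`. -/
def dvdSubgroup (i j : ZMod (2 * n)) : Subgroup (QuaternionGroup n) where
  carrier := {g | match g with
    | a k => expMod n i ∣ expMod n k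
    | xa k => expMod n i ∣ expMod n k - expMod n j}
  one_mem' := by
    change expMod n i ∣ expMod n 0
    simp
  mul_mem' := by
    rintro (k | k) (l | l) hk hl <;>
      simp only [Set.mem_ofPred_eq, a_mul_a, a_mul_xa, xa_mul_a, xa_mul_xa, map_add, map_sub,
        expMod_natCast_self] at hk hl ⊢
    · exact dvd_add hk hl
    · convert dvd_sub hl hk using 1; ring
    · convert dvd_add hk hl using 1; ring
    · convert dvd_sub hl hk using 1; ring
  inv_mem' := by
    rintro (k | k) hk
    · simpa [inv_a] using hk
    · simpa only [inv_xa, Set.mem_ofPred_eq, map_add, expMod_natCast_self, zero_add] using hk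

/-- The cyclic subgroup of the elements `a k`. -/
def rotations (n : ℕ) : Subgroup (QuaternionGroup n) where
  carrier := Set.range a
  one_mem' := ⟨0, rfl⟩
  mul_mem' := by
    rintro _ _ ⟨k, rfl⟩ ⟨l, rfl⟩
    exact ⟨k + l, rfl⟩
  inv_mem' := by
    rintro _ ⟨k, rfl⟩
    exact ⟨-k, rfl⟩

theorem closure_a_a_ne_top (i j : ZMod (2 * n)) :
    Subgroup.closure ({a i, a j} : Set (QuaternionGroup n)) ≠ ⊤ := by
  intro h
  have hle : Subgroup.closure ({a i, a j} : Set (QuaternionGroup n)) ≤ rotations n := by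
    rw [Subgroup.closure_le]
    rintro _ (rfl | rfl)
    exacts [⟨i, rfl⟩, ⟨j, rfl⟩]
  obtain ⟨k, hk⟩ := hle (h ▸ Subgroup.mem_top (xa 0))
  cases hk

theorem closure_a_xa_eq_top_iff [NeZero n] (i j : ZMod (2 * n)) :
    Subgroup.closure ({a i, xa j} : Set (QuaternionGroup n)) = ⊤ ↔ IsUnit (expMod n i) := by
  constructor
  · intro h
    have hle : Subgroup.closure ({a i, xa j} : Set (QuaternionGroup n)) ≤ dvdSubgroup i j := by
      rw [Subgroup.closure_le]
      rintro _ (rfl | rfl)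
      · exact dvd_refl (expMod n i)
      · change expMod n i ∣ expMod n j - expMod n j
        simp
    have h1 : expMod n i ∣ expMod n 1 := hle (h ▸ Subgroup.mem_top (a 1))
    rw [map_one] at h1
    exact isUnit_of_dvd_one h1
  · intro hu
    set H := Subgroup.closure ({a i, xa j} : Set (QuaternionGroup n)) with hH
    have hi : a i ∈ H := Subgroup.subset_closure (by simp)
    have hj : xa j ∈ H := Subgroup.subset_closure (by simp)
    have hn : a (n : ZMod (2 * n)) ∈ H := xa_sq j ▸ H.pow_mem hj 2
    obtain ⟨v, hv⟩ := hu.exists_right_inv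
    obtain ⟨u, rfl⟩ := ZMod.ringHom_surjective (expMod n) v
    have hker : (n : ZMod (2 * n)) ∣ 1 - i * u :=
      natCast_dvd_of_expMod_eq_zero (by simp [hv])
    have hone : a (1 : ZMod (2 * n)) ∈ H := by
      have h := H.mul_mem (a_mem_of_dvd hi (dvd_mul_right i u)) (a_mem_of_dvd hn hker)
      rwa [a_mul_a, add_sub_cancel] at h
    have ha (k : ZMod (2 * n)) : a k ∈ H := a_mem_of_dvd hone (one_dvd k)
    rw [eq_top_iff]
    rintro (k | k) -
    · exact ha k
    · have h := H.mul_mem hj (ha (k - j))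
      rwa [xa_mul_a, add_sub_cancel] at h

theorem closure_xa_xa (i j : ZMod (2 * n)) :
    Subgroup.closure ({xa i, xa j} : Set (QuaternionGroup n)) =
      Subgroup.closure {a ((n : ZMod (2 * n)) + j - i), xa i} := by
  apply le_antisymm <;> rw [Subgroup.closure_le] <;> rintro _ (rfl | rfl)
  · exact Subgroup.subset_closure (by simp)
  · have h : xa j = (xa i)⁻¹ * a ((n : ZMod (2 * n)) + j - i) := by rw [← xa_mul_xa]; group
    rw [h]
    exact mul_mem (inv_mem (Subgroup.subset_closure (by simp)))
      (Subgroup.subset_closure (by simp))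
  · rw [← xa_mul_xa]
    exact mul_mem (Subgroup.subset_closure (by simp)) (Subgroup.subset_closure (by simp))
  · exact Subgroup.subset_closure (by simp)

theorem sum_eq_sum_a_add_sum_xa [NeZero n] (f : QuaternionGroup n → ℕ) :
    ∑ g, f g = ∑ i, f (a i) + ∑ i, f (xa i) := by
  let e : ZMod (2 * n) ⊕ ZMod (2 * n) ≃ QuaternionGroup n :=
    { toFun := Sum.elim a xa
      invFun := fun g => match g with
        | a i => Sum.inl i
        | xa i => Sum.inr i
      left_inv := by rintro (i | i) <;> rfl
      right_inv := by rintro (i | i) <;> rfl }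
  rw [← e.sum_comp, Fintype.sum_sum_type]
  rfl

theorem sum_isUnit_expMod [NeZero n] :
    ∑ i : ZMod (2 * n), (if IsUnit (expMod n i) then 1 else 0) = 2 * Nat.totient n := by
  have hunit (i : ZMod (2 * n)) : IsUnit (expMod n i) ↔ n.Coprime i.val := by
    conv_lhs => rw [← ZMod.natCast_zmod_val i, map_natCast]
    rw [ZMod.isUnit_iff_coprime, Nat.coprime_comm]
  have hrange : ∑ i : ZMod (2 * n), (if n.Coprime i.val then 1 else 0) =
      ∑ k ∈ Finset.range (2 * n), if n.Coprime k then 1 else 0 :=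
    Finset.sum_bij (fun i _ => i.val) (fun i _ => Finset.mem_range.2 i.val_lt)
      (fun i _ j _ h => ZMod.val_injective _ h)
      (fun k hk => ⟨k, Finset.mem_univ _, ZMod.val_cast_of_lt (Finset.mem_range.1 hk)⟩)
      (fun _ _ => rfl)
  simp only [hunit]
  rw [hrange, two_mul, Finset.sum_range_add]
  simp only [Nat.coprime_self_add_right]
  rw [Nat.totient, Finset.card_filter]
  ring

theorem card_generating_pairs [NeZero n] :
    (Finset.univ.filter (fun p : QuaternionGroup n × QuaternionGroup n =>
        Subgroup.closure ({p.1, p.2} : Set (QuaternionGroup n)) = ⊤)).card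
      = 12 * n * Nat.totient n := by
  have hshift (i : ZMod (2 * n)) :
      ∑ j, (if IsUnit (expMod n ((n : ZMod (2 * n)) + j - i)) then 1 else 0) =
        2 * Nat.totient n := by
    rw [← sum_isUnit_expMod]
    refine Fintype.sum_equiv (Equiv.addLeft ((n : ZMod (2 * n)) - i)) _ _ fun j => ?_
    simp only [Equiv.coe_addLeft, sub_add_eq_add_sub]
  have hswap (i j : ZMod (2 * n)) :
      Subgroup.closure ({xa i, a j} : Set (QuaternionGroup n)) = ⊤ ↔ IsUnit (expMod n j) := by
    rw [Set.pair_comm, closure_a_xa_eq_top_iff]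
  rw [Finset.card_filter, Fintype.sum_prod_type, sum_eq_sum_a_add_sum_xa]
  simp only [sum_eq_sum_a_add_sum_xa, closure_xa_xa, closure_a_xa_eq_top_iff, hswap,
    closure_a_a_ne_top, if_false, Finset.sum_const_zero, zero_add, Finset.sum_add_distrib,
    hshift, sum_isUnit_expMod, Finset.sum_const, Finset.card_univ, ZMod.card, smul_eq_mul,
    ← Finset.mul_sum]
  ring

end QuaternionGroup

/-- For `n ≥ 2`, the number of ordered pairs `(g, h)` of elements of the dicyclic group `Q_n`
with `⟨g, h⟩ = Q_n` equals `12 n φ(n)`; consequently, the probability that two distinct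
randomly chosen elements of `Q_n` generate `Q_n` is `3 φ(n) / (4n - 1)`. -/
theorem dicyclic_gen_count (n : ℕ) (hn : 2 ≤ n) :
    haveI : NeZero n := ⟨by omega⟩
    (Finset.univ.filter (fun p : QuaternionGroup n × QuaternionGroup n =>
        Subgroup.closure ({p.1, p.2} : Set (QuaternionGroup n)) = ⊤)).card
      = 12 * n * Nat.totient n ∧
    ((Finset.univ.filter (fun p : QuaternionGroup n × QuaternionGroup n =>
        Subgroup.closure ({p.1, p.2} : Set (QuaternionGroup n)) = ⊤)).card : ℚ)
        / (2 * ((4 * n).choose 2))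
      = 3 * Nat.totient n / (4 * n - 1) := by
  have : NeZero n := ⟨by omega⟩
  have hcard := QuaternionGroup.card_generating_pairs (n := n)
  refine ⟨hcard, ?_⟩
  rw [hcard, Nat.cast_choose_two]
  have hn' : (2 : ℚ) ≤ n := by exact_mod_cast hn
  have h : (4 * n - 1 : ℚ) ≠ 0 := by linarith
  push_cast
  field_simp
  ring
end

section
/- For every integer n ≥ 2, the set of isolated vertices of the generating graph Γ(Q_n), namely {g ∈ Q_n : for all z ∈ Q_n, the subgroup generated by {g,z} is not all of Q_n}, coincides with the underlying set of the Frattini subgroup of Q_n if and only if n is a prime power. -/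
namespace QuaternionGroup

variable {n : ℕ}

/-- The exponents `k` with `a k ∈ H`, as an additive subgroup. -/
def rotationExponents (H : Subgroup (QuaternionGroup n)) : AddSubgroup (ZMod (2 * n)) where
  carrier := {k | a k ∈ H}
  zero_mem' := H.one_mem
  add_mem' hx hy := H.mul_mem hx hy
  neg_mem' hx := H.inv_mem hx

theorem mem_rotationExponents {H : Subgroup (QuaternionGroup n)} {k : ZMod (2 * n)} :
    k ∈ rotationExponents H ↔ a k ∈ H := Iff.rfl

theorem rotationExponents_eq_top_of_coprime {H : Subgroup (QuaternionGroup n)} {x y : ℕ}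
    (hx : a (x : ZMod (2 * n)) ∈ H) (hy : a (y : ZMod (2 * n)) ∈ H) (h : x.Coprime y) :
    rotationExponents H = ⊤ := by
  have h1 : (1 : ZMod (2 * n)) ∈ rotationExponents H := by
    have hb := Nat.gcd_eq_gcd_ab x y
    rw [h.gcd_eq_one] at hb
    have hb' := congrArg (Int.cast : ℤ → ZMod (2 * n)) hb
    push_cast at hb'
    rw [hb', mul_comm (x : ZMod (2 * n)), mul_comm (y : ZMod (2 * n)), ← zsmul_eq_mul,
      ← zsmul_eq_mul]
    exact add_mem (zsmul_mem (mem_rotationExponents.2 hx) _)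
      (zsmul_mem (mem_rotationExponents.2 hy) _)
  refine eq_top_iff.2 fun k _ => ?_
  obtain ⟨m, rfl⟩ := ZMod.intCast_surjective k
  simpa using zsmul_mem h1 m

theorem eq_top_of_rotationExponents_eq_top {H : Subgroup (QuaternionGroup n)}
    (h : rotationExponents H = ⊤) {j : ZMod (2 * n)} (hj : xa j ∈ H) : H = ⊤ := by
  have ha (k : ZMod (2 * n)) : a k ∈ H := mem_rotationExponents.1 (h ▸ AddSubgroup.mem_top k)
  refine eq_top_iff.2 fun g _ => ?_
  rcases g with k | k
  · exact ha k
  · simpa using H.mul_mem hj (ha (k - j))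

theorem eq_top_of_coprime [NeZero n] {H : Subgroup (QuaternionGroup n)} {i j : ZMod (2 * n)}
    (hi : a i ∈ H) (hj : xa j ∈ H) (h : i.val.Coprime n) : H = ⊤ := by
  refine eq_top_of_rotationExponents_eq_top (rotationExponents_eq_top_of_coprime ?_ ?_ h) hj
  · simpa using hi
  · simpa using H.pow_mem hj 2

/-- For `d ∣ n`, the subgroup of all `a k` with `k ≡ 0` and all `xa k` with `k ≡ c` modulo `d`. -/
def congruenceSubgroup {d : ℕ} (hd : d ∣ n) (c : ZMod d) : Subgroup (QuaternionGroup n) where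
  carrier := {g | match g with
    | a k => ZMod.castHom (hd.mul_left 2) (ZMod d) k = 0
    | xa k => ZMod.castHom (hd.mul_left 2) (ZMod d) k = c}
  one_mem' := map_zero (ZMod.castHom (hd.mul_left 2) (ZMod d))
  mul_mem' := by
    have hn : (n : ZMod d) = 0 := (ZMod.natCast_eq_zero_iff _ _).2 hd
    rintro (x | x) (y | y) hx hy <;>
      simp only [Set.mem_ofPred_eq, a_mul_a, a_mul_xa, xa_mul_a, xa_mul_xa, map_add, map_sub,
        map_natCast] at hx hy ⊢ <;> simp [hx, hy, hn]
  inv_mem' := by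
    have hn : (n : ZMod d) = 0 := (ZMod.natCast_eq_zero_iff _ _).2 hd
    rintro (x | x) hx
    · change ZMod.castHom (hd.mul_left 2) (ZMod d) (-x) = 0
      rw [map_neg, hx, neg_zero]
    · change ZMod.castHom (hd.mul_left 2) (ZMod d) (n + x) = c
      rw [map_add, map_natCast, hn, zero_add, hx]

theorem a_mem_congruenceSubgroup {d : ℕ} (hd : d ∣ n) (c : ZMod d) (k : ZMod (2 * n)) :
    a k ∈ congruenceSubgroup hd c ↔ ZMod.castHom (hd.mul_left 2) (ZMod d) k = 0 := Iff.rfl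

theorem xa_mem_congruenceSubgroup {d : ℕ} (hd : d ∣ n) (c : ZMod d) (k : ZMod (2 * n)) :
    xa k ∈ congruenceSubgroup hd c ↔ ZMod.castHom (hd.mul_left 2) (ZMod d) k = c := Iff.rfl

theorem a_natCast_mem_congruenceSubgroup {d : ℕ} (hd : d ∣ n) (c : ZMod d) (m : ℕ) :
    a (m : ZMod (2 * n)) ∈ congruenceSubgroup hd c ↔ d ∣ m := by
  rw [a_mem_congruenceSubgroup, map_natCast, ZMod.natCast_eq_zero_iff]

theorem congruenceSubgroup_ne_top {d : ℕ} (hd : d ∣ n) (c : ZMod d) (h1 : d ≠ 1) :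
    congruenceSubgroup hd c ≠ ⊤ := by
  intro h
  have := (a_natCast_mem_congruenceSubgroup hd c 1).1 (h ▸ Subgroup.mem_top _)
  exact h1 (Nat.dvd_one.1 this)

theorem a_mem_zpowers [NeZero n] (k : ZMod (2 * n)) :
    a k ∈ Subgroup.zpowers (a 1 : QuaternionGroup n) :=
  ⟨k.val, by simp only [zpow_natCast, a_one_pow, ZMod.natCast_zmod_val]⟩

theorem zpowers_ne_top (hn : 2 ≤ n) (g : QuaternionGroup n) : Subgroup.zpowers g ≠ ⊤ := by
  intro h
  have hg (x : QuaternionGroup n) : x ∈ Subgroup.zpowers g := h ▸ Subgroup.mem_top x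
  obtain ⟨s, hs⟩ := hg (a 1)
  obtain ⟨t, ht⟩ := hg (xa 0)
  have hc : a 1 * xa 0 = (xa 0 * a 1 : QuaternionGroup n) := by
    rw [← hs, ← ht]
    exact zpow_mul_comm g s t
  rw [a_mul_xa, xa_mul_a] at hc
  have h2 : ((2 : ℕ) : ZMod (2 * n)) = 0 := by
    have := xa.inj hc
    push_cast
    linear_combination -this
  have := Nat.le_of_dvd two_pos ((ZMod.natCast_eq_zero_iff _ _).1 h2)
  omega

theorem closure_pair_ne_top_of_mem_frattini (hn : 2 ≤ n) {g : QuaternionGroup n}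
    (hg : g ∈ frattini (QuaternionGroup n)) (z : QuaternionGroup n) :
    Subgroup.closure ({g, z} : Set (QuaternionGroup n)) ≠ ⊤ := by
  have : NeZero n := ⟨by omega⟩
  intro h
  refine zpowers_ne_top hn z (frattini_nongenerating (eq_top_iff.2 (h ▸ ?_)))
  rw [Subgroup.closure_le]
  rintro x (rfl | rfl)
  · exact Subgroup.mem_sup_right hg
  · exact Subgroup.mem_sup_left (Subgroup.mem_zpowers _)

theorem closure_a_natCast_pair_ne_top (hn : 2 ≤ n) {p : ℕ} (hpn : p ∣ n) (hp : p ≠ 1)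
    (z : QuaternionGroup n) :
    Subgroup.closure ({a (p : ZMod (2 * n)), z} : Set (QuaternionGroup n)) ≠ ⊤ := by
  have : NeZero n := ⟨by omega⟩
  rcases z with k | k
  · refine ne_top_of_le_ne_top (zpowers_ne_top hn (a 1)) ?_
    rw [Subgroup.closure_le]
    rintro x (rfl | rfl) <;> exact a_mem_zpowers _
  · refine ne_top_of_le_ne_top
      (congruenceSubgroup_ne_top hpn (ZMod.castHom (hpn.mul_left 2) (ZMod p) k) hp) ?_
    rw [Subgroup.closure_le]
    rintro x (rfl | rfl)
    · exact (a_natCast_mem_congruenceSubgroup hpn _ p).2 dvd_rfl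
    · exact (xa_mem_congruenceSubgroup hpn _ k).2 rfl

theorem a_natCast_notMem_frattini [NeZero n] {p q : ℕ} (hqn : q ∣ n) (hq : q ≠ 1)
    (hpq : p.Coprime q) : a (p : ZMod (2 * n)) ∉ frattini (QuaternionGroup n) := by
  intro h
  refine congruenceSubgroup_ne_top hqn 0 hq (frattini_nongenerating ?_)
  refine eq_top_of_rotationExponents_eq_top (j := 0)
    (rotationExponents_eq_top_of_coprime (Subgroup.mem_sup_right h) ?_ hpq) ?_
  · exact Subgroup.mem_sup_left ((a_natCast_mem_congruenceSubgroup hqn _ q).2 dvd_rfl)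
  · exact Subgroup.mem_sup_left ((xa_mem_congruenceSubgroup hqn _ 0).2 (map_zero _))

theorem a_mem_frattini_of_isPrimePow [NeZero n] (hn : IsPrimePow n) {i : ZMod (2 * n)}
    (hi : ¬ i.val.Coprime n) : a i ∈ frattini (QuaternionGroup n) := by
  obtain ⟨p, r, hp, hr, hpr⟩ := (isPrimePow_nat_iff n).1 hn
  have hpn : p ∣ n := hpr ▸ dvd_pow_self p hr.ne'
  have key {k : ZMod (2 * n)} (hk : ¬ k.val.Coprime n) :
      ZMod.castHom (hpn.mul_left 2) (ZMod p) k = 0 := by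
    rw [← ZMod.natCast_zmod_val k, map_natCast, ZMod.natCast_eq_zero_iff]
    generalize k.val = m at hk
    rwa [← hpr, Nat.coprime_pow_right_iff hr, Nat.coprime_comm, hp.coprime_iff_not_dvd,
      not_not] at hk
  have hnp : (n : ZMod p) = 0 := (ZMod.natCast_eq_zero_iff _ _).2 hpn
  simp only [frattini, Order.radical, Subgroup.mem_iInf]
  intro M hM
  by_cases hx : ∃ j, xa j ∈ M
  · obtain ⟨j, hj⟩ := hx
    have hrot {k : ZMod (2 * n)} (hk : a k ∈ M) :
        ZMod.castHom (hpn.mul_left 2) (ZMod p) k = 0 :=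
      key fun h => hM.1 (eq_top_of_coprime hk hj h)
    have hle : M ≤ congruenceSubgroup hpn (ZMod.castHom (hpn.mul_left 2) (ZMod p) j) := by
      rintro (k | k) hk
      · exact hrot hk
      · have := hrot (M.mul_mem hj hk)
        rw [map_sub, map_add, map_natCast, hnp, zero_add, sub_eq_zero] at this
        exact this
    rw [(hM.le_iff_eq (congruenceSubgroup_ne_top hpn _ hp.one_lt.ne')).1 hle |>.symm]
    exact key hi
  · push Not at hx
    have hle : M ≤ Subgroup.zpowers (a 1) := by
      rintro (k | k) hk
      · exact a_mem_zpowers k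
      · exact absurd hk (hx k)
    have hn2 : 2 ≤ n := hn.two_le
    rw [(hM.le_iff_eq (zpowers_ne_top hn2 _)).1 hle |>.symm]
    exact a_mem_zpowers i

end QuaternionGroup

/-- A natural number `n ≥ 2` that is not a prime power has two coprime divisors other than `1`. -/
theorem Nat.exists_coprime_dvd_of_not_isPrimePow {n : ℕ} (hn : 2 ≤ n) (h : ¬ IsPrimePow n) :
    ∃ p q : ℕ, p ∣ n ∧ q ∣ n ∧ p ≠ 1 ∧ q ≠ 1 ∧ p.Coprime q := by
  have hp := Nat.minFac_prime (show n ≠ 1 by omega)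
  obtain ⟨e, m, hm, hnm⟩ :=
    Nat.exists_eq_pow_mul_and_not_dvd (show n ≠ 0 by omega) n.minFac hp.ne_one
  have he : e ≠ 0 := by
    rintro rfl
    rw [pow_zero, one_mul] at hnm
    exact hm (hnm ▸ n.minFac_dvd)
  refine ⟨n.minFac, m, n.minFac_dvd, Dvd.intro_left _ hnm.symm, hp.ne_one, ?_,
    hp.coprime_iff_not_dvd.2 hm⟩
  rintro rfl
  rw [mul_one] at hnm
  exact h ((isPrimePow_nat_iff n).2 ⟨_, e, hp, Nat.pos_of_ne_zero he, hnm.symm⟩)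

open QuaternionGroup


/-- For `n ≥ 2`, the set of isolated vertices of the generating graph `Γ(Q_n)` coincides with
the Frattini subgroup of `Q_n` iff `n` is a prime power. -/
theorem dicyclic_isolated_eq_frattini_iff (n : ℕ) (hn : 2 ≤ n) :
    ({g : QuaternionGroup n |
        ∀ z : QuaternionGroup n, Subgroup.closure ({g, z} : Set (QuaternionGroup n)) ≠ ⊤}
      = (frattini (QuaternionGroup n) : Set (QuaternionGroup n))) ↔ IsPrimePow n := by
  have : NeZero n := ⟨by omega⟩
  constructor
  · intro h
    by_contra hpow
    obtain ⟨p, q, hpn, hqn, hp, hq, hpq⟩ := Nat.exists_coprime_dvd_of_not_isPrimePow hn hpow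
    refine a_natCast_notMem_frattini hqn hq hpq ?_
    rw [← SetLike.mem_coe, ← h]
    exact closure_a_natCast_pair_ne_top hn hpn hp
  · intro hpow
    refine Set.Subset.antisymm ?_ fun g hg => closure_pair_ne_top_of_mem_frattini hn hg
    rintro (i | i) hi
    · refine a_mem_frattini_of_isPrimePow hpow fun hc => hi (xa 0) ?_
      exact eq_top_of_coprime (j := 0) (Subgroup.subset_closure (by simp))
        (Subgroup.subset_closure (by simp)) hc
    · refine absurd ?_ (hi (a 1))
      refine eq_top_of_coprime (i := 1) (j := i) (Subgroup.subset_closure (by simp))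
        (Subgroup.subset_closure (by simp)) ?_
      rw [ZMod.val_one'' (by omega)]
      exact Nat.coprime_one_left n
end
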